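/- Let N be a network on n nodes with γ protocols and nonnegative cost function w, and let S, D be nodes. Every feasible path from S to D that has the minimum number of hops among all feasible paths from S to D reaches a maximum stack height of at most γ·n² protocols. -/

import Mathlib

/-- An adaptation function over a protocol set `A`: a conversion `(a→b)`,
an encapsulation `(a→ab)`, or a decapsulation `(a→ab)‾`. -/
inductive AdaptFun (A : Type) where
  | conv : A → A → AdaptFun A
  | encap : A → A → AdaptFun A
  | decap : A → A → AdaptFun A
deriving DecidableEq

/-- The partial action of an adaptation function on a protocol stack
(a list whose head is the top of the stack). -/
def AdaptFun.apply {A : Type} [DecidableEq A] : AdaptFun A → List A → Option (List A)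
  | .conv a b, x :: T => if x = a then some (b :: T) else none
  | .encap a b, x :: T => if x = a then some (b :: a :: T) else none
  | .decap a b, y :: x :: T => if y = b ∧ x = a then some (a :: T) else none
  | _, _ => none

/-- A network: a symmetric directed graph on node set `V`, adaptation functions `F U`
available at each node, receivable protocols `In U`, and a nonnegative cost function `w`. -/
structure Network (A V : Type) where
  E : V → V → Prop
  symm : ∀ u v, E u v ↔ E v u
  F : V → Set (AdaptFun A)
  In : V → Set A
  w : V → AdaptFun A → V → ℝ
  w_nonneg : ∀ u f v, 0 ≤ w u f v

/-- A path `S f₀ U₁ f₁ … U_ℓ f_ℓ D`: `len` is `ℓ`, `nodes i` is `U_i`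
(with `nodes 0 = S` and `nodes (ℓ+1) = D`), and `funs i` is `f_i`. -/
structure NetPath (A V : Type) where
  len : ℕ
  nodes : ℕ → V
  funs : ℕ → AdaptFun A

/-- The stack sequence of a path: `H₀ = [x]` where `f₀` is the conversion `(x→x)`,
and `H_i = f_i (H_{i-1})`. -/
def NetPath.stack {A V : Type} [DecidableEq A] (P : NetPath A V) : ℕ → Option (List A)
  | 0 =>
    match P.funs 0 with
    | .conv a b => if a = b then some [a] else none
    | _ => none
  | i + 1 => (P.stack i).bind (P.funs (i + 1)).apply

/-- Feasibility of a path from `S` to `D` in the network `N`. -/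
def Feasible {A V : Type} [DecidableEq A] (N : Network A V) (S D : V)
    (P : NetPath A V) : Prop :=
  P.nodes 0 = S ∧ P.nodes (P.len + 1) = D ∧
  (∀ i ≤ P.len, N.E (P.nodes i) (P.nodes (i + 1))) ∧
  (∀ i, 1 ≤ i → i ≤ P.len → P.funs i ∈ N.F (P.nodes i)) ∧
  (∃ x, P.funs 0 = .conv x x) ∧
  (∀ i ≤ P.len, (P.stack i).isSome) ∧
  (∃ y ∈ N.In D, P.stack P.len = some [y])

/-- The cost of a path: `w(P) = Σ_{i=0}^{ℓ} w(U_i, f_i, U_{i+1})`. -/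
def pathCost {A V : Type} (N : Network A V) (P : NetPath A V) : ℝ :=
  ∑ i ∈ Finset.range (P.len + 1), N.w (P.nodes i) (P.funs i) (P.nodes (i + 1))

/-- The maximum stack height `max_i |H_i|` reached along a path. -/
def NetPath.maxHeight {A V : Type} [DecidableEq A] (P : NetPath A V) : ℕ :=
  (Finset.range (P.len + 1)).sup fun i => ((P.stack i).map List.length).getD 0

namespace AdaptFun

variable {A : Type} [DecidableEq A] {f : AdaptFun A}

theorem length_le_of_apply {L L' : List A} (h : f.apply L = some L') :
    L'.length ≤ L.length + 1 ∧ L.length ≤ L'.length + 1 := by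
  unfold apply at h
  split at h <;> simp_all <;> grind

theorem apply_eq_cons_of_length_lt {L L' : List A} (h : f.apply L = some L')
    (hlt : L.length < L'.length) : ∃ y, L' = y :: L := by
  unfold apply at h
  split at h <;> simp_all <;> grind

theorem exists_append_of_apply {R T L : List A} (hR : R ≠ [])
    (h : f.apply (R ++ T) = some L) : ∃ R', L = R' ++ T := by
  obtain ⟨r, R, rfl⟩ := List.exists_cons_of_ne_nil hR
  unfold apply at h
  split at h
  · simp at h
    grind
  · rename_i a b x T' heq
    simp at h heq
    exact ⟨b :: a :: R, by simp [← h.2, heq.2]⟩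
  · rename_i a b y x T' heq
    simp at h heq
    exact ⟨R, by simp [← h.2, heq.2, h.1.2]⟩
  · simp at h

/-- The action on the top part of a stack does not depend on the part below. -/
theorem apply_append_congr {R R' T : List A} (T' : List A) (hR : R ≠ []) (hR' : R' ≠ [])
    (h : f.apply (R ++ T) = some (R' ++ T)) : f.apply (R ++ T') = some (R' ++ T') := by
  obtain ⟨r, R, rfl⟩ := List.exists_cons_of_ne_nil hR
  obtain ⟨r', R', rfl⟩ := List.exists_cons_of_ne_nil hR'
  cases f with
  | conv a b => simp [apply] at h ⊢; grind
  | encap a b =>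
    simp only [apply, List.cons_append] at h ⊢
    split at h
    · simp only [Option.some.injEq, List.cons.injEq] at h
      have h2 : (a :: R) ++ T = R' ++ T := by simpa using h.2
      simp [*, ← List.append_cancel_right h2]
    · simp at h
  | decap a b =>
    cases R with
    | nil =>
      cases T with
      | nil => simp [apply] at h
      | cons t T =>
        simp only [apply, List.cons_append, List.nil_append] at h
        split at h
        · have := congrArg (Option.map List.length) h
          simp at this
          omega
        · simp at h
    | cons s R =>
      simp only [apply, List.cons_append] at h ⊢
      split at h
      · simp only [Option.some.injEq, List.cons.injEq] at h
        have := List.append_cancel_right h.2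
        simp_all
      · simp at h

end AdaptFun

theorem exists_last_eq_before {H : ℕ → ℕ} {m k : ℕ} (hstep : ∀ i < m, H (i + 1) ≤ H i + 1)
    (h0 : H 0 ≤ k) (hm : k ≤ H m) :
    ∃ a ≤ m, H a = k ∧ ∀ i, a < i → i ≤ m → k < H i := by
  have hspec : H (Nat.findGreatest (fun i => H i ≤ k) m) ≤ k :=
    Nat.findGreatest_spec (P := fun i => H i ≤ k) (Nat.zero_le m) h0
  have hgt : ∀ i, Nat.findGreatest (fun i => H i ≤ k) m < i → i ≤ m → k < H i :=
    fun i h1 h2 => not_le.mp (Nat.findGreatest_is_greatest (P := fun i => H i ≤ k) h1 h2)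
  have hle := Nat.findGreatest_le (P := fun i => H i ≤ k) m
  generalize Nat.findGreatest (fun i => H i ≤ k) m = a at hspec hgt hle
  refine ⟨a, hle, ?_, hgt⟩
  rcases hle.eq_or_lt with rfl | hlt
  · omega
  · have := hgt (a + 1) (by omega) hlt
    have := hstep a hlt
    omega

theorem exists_first_eq_after {H : ℕ → ℕ} {m l k : ℕ} (hml : m ≤ l)
    (hstep : ∀ i < l, H i ≤ H (i + 1) + 1) (hl : H l ≤ k) (hm : k ≤ H m) :
    ∃ b, m ≤ b ∧ b ≤ l ∧ H b = k ∧ ∀ i, m ≤ i → i < b → k < H i := by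
  obtain ⟨a, ha, haeq, hlt⟩ := exists_last_eq_before (H := fun i => H (l - i)) (m := l - m) (k := k)
    (fun i hi => by
      have := hstep (l - (i + 1)) (by omega)
      rwa [show l - (i + 1) + 1 = l - i by omega] at this)
    (by simpa using hl) (by simpa [Nat.sub_sub_self hml] using hm)
  refine ⟨l - a, by omega, by omega, haeq, fun i h1 h2 => ?_⟩
  have := hlt (l - i) (by omega) (by omega)
  rwa [show l - (l - i) = i by omega] at this

namespace Network

variable {A V : Type} [DecidableEq A]

/-- One hop between configurations: the node holding the packet applies one of its adaptation
functions to the stack and forwards the packet to a neighbour. -/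
def Step (N : Network A V) (c d : V × List A) : Prop :=
  N.E c.1 d.1 ∧ ∃ f ∈ N.F c.1, f.apply c.2 = some d.2

/-- `N.Run n c d`: the configuration `d` is reached from `c` in exactly `n` hops. -/
inductive Run (N : Network A V) : ℕ → V × List A → V × List A → Prop
  | refl (c : V × List A) : Run N 0 c c
  | tail {n : ℕ} {c d e : V × List A} : Run N n c d → N.Step d e → Run N (n + 1) c e

variable {N : Network A V}

theorem Run.trans {m n : ℕ} {c d e : V × List A} (h₁ : N.Run m c d) (h₂ : N.Run n d e) :
    N.Run (m + n) c e := by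
  induction h₂ with
  | refl => exact h₁
  | tail _ hs ih => exact (ih h₁).tail hs

theorem run_of_forall_step {g : ℕ → V × List A} {a b : ℕ} (hab : a ≤ b)
    (h : ∀ i, a ≤ i → i < b → N.Step (g i) (g (i + 1))) : N.Run (b - a) (g a) (g b) := by
  induction b, hab using Nat.le_induction with
  | base => simpa using Run.refl _
  | succ b hab ih =>
    rw [Nat.sub_add_comm hab]
    exact (ih fun i h1 h2 => h i h1 (by omega)).tail (h b hab (by omega))

theorem Run.exists_seq {n : ℕ} {c d : V × List A} (h : N.Run n c d) :
    ∃ g : ℕ → V × List A, g 0 = c ∧ g n = d ∧ ∀ i < n, N.Step (g i) (g (i + 1)) := by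
  induction h with
  | refl c => exact ⟨fun _ => c, rfl, rfl, by simp⟩
  | @tail n c d e _ hs ih =>
    obtain ⟨g, h0, hn, hg⟩ := ih
    refine ⟨fun i => if i ≤ n then g i else e, by simpa using h0, by simp, fun i hi => ?_⟩
    rcases (Nat.lt_succ_iff.mp hi).eq_or_lt with rfl | hlt
    · simpa [hn] using hs
    · simpa [hlt.le, Nat.succ_le_of_lt hlt] using hg i hlt

theorem Run.exists_feasible {n : ℕ} {S D U : V} {x y : A} (hE : N.E S U)
    (h : N.Run n (U, [x]) (D, [y])) (hy : y ∈ N.In D) :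
    ∃ Q : NetPath A V, Feasible N S D Q ∧ Q.len = n := by
  obtain ⟨g, h0, hn, hg⟩ := h.exists_seq
  have hf : ∀ i, ∃ f : AdaptFun A,
      i < n → f ∈ N.F (g i).1 ∧ f.apply (g i).2 = some (g (i + 1)).2 := fun i => by
    by_cases hi : i < n
    · obtain ⟨-, f, hf⟩ := hg i hi
      exact ⟨f, fun _ => hf⟩
    · exact ⟨.conv x x, fun h => absurd h hi⟩
  choose f hf using hf
  let Q : NetPath A V :=
    { len := n
      nodes := fun i => i.casesOn S fun j => (g j).1
      funs := fun i => i.casesOn (.conv x x) f }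
  have hstack : ∀ i ≤ n, Q.stack i = some (g i).2 := by
    intro i
    induction i with
    | zero => intro _; simp [NetPath.stack, Q, h0]
    | succ i ih =>
      intro hi
      rw [NetPath.stack, ih (by omega)]
      exact (hf i hi).2
  refine ⟨Q, ⟨rfl, by simp [Q, hn], ?_, ?_, ⟨x, rfl⟩, ?_, y, hy, ?_⟩, rfl⟩
  · rintro (_ | i) hi
    · simpa [Q, h0] using hE
    · exact (hg i hi).1
  · rintro (_ | i) h1 hi
    · omega
    · exact (hf i hi).1
  · intro i hi
    simp [hstack i hi]
  · simpa [hn] using hstack n le_rfl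

/-- In a run that rises to time `m` and returns, each height `k` between the end heights and the
height at time `m` is entered and left with the same stack `x :: T`, and in between `T` stays
untouched, so that it can be replaced by any other stack. -/
theorem exists_excursion {g : ℕ → V × List A} {l m k : ℕ} (hml : m ≤ l)
    (hg : ∀ i < l, N.Step (g i) (g (i + 1))) (hk : 1 ≤ k) (h0 : (g 0).2.length ≤ k)
    (hl : (g l).2.length ≤ k) (hm : k ≤ (g m).2.length) :
    ∃ a b x T, a ≤ m ∧ m ≤ b ∧ b ≤ l ∧ (g a).2 = x :: T ∧ (g b).2 = x :: T ∧
      T.length + 1 = k ∧ (∀ i, a ≤ i → i ≤ b → k ≤ (g i).2.length) ∧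
      ∀ T', N.Run (b - a) ((g a).1, x :: T') ((g b).1, x :: T') := by
  have hlen : ∀ i < l, (g (i + 1)).2.length ≤ (g i).2.length + 1 ∧
      (g i).2.length ≤ (g (i + 1)).2.length + 1 := fun i hi => by
    obtain ⟨-, f, -, hf⟩ := hg i hi
    exact f.length_le_of_apply hf
  obtain ⟨a, ham, hak, ha⟩ := exists_last_eq_before (H := fun i => (g i).2.length)
    (fun i hi => (hlen i (by omega)).1) h0 hm
  obtain ⟨b, hmb, hbl, hbk, hb⟩ := exists_first_eq_after (H := fun i => (g i).2.length) hml
    (fun i hi => (hlen i hi).2) hl hm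
  obtain ⟨x, T, hxT⟩ : ∃ x T, (g a).2 = x :: T :=
    List.exists_cons_of_ne_nil (by rintro h; simp [h] at hak; omega)
  have hTk : T.length + 1 = k := by simpa [hxT] using hak
  have hmid : ∀ i, a < i → i < b → k < (g i).2.length := fun i h1 h2 => by
    rcases le_total i m with h | h
    · exact ha i h1 h
    · exact hb i h h2
  have hge : ∀ i, a ≤ i → i ≤ b → k ≤ (g i).2.length := fun i h1 h2 => by
    rcases h1.eq_or_lt with rfl | h1
    · exact hak.ge
    rcases h2.eq_or_lt with rfl | h2
    · exact hbk.ge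
    exact (hmid i h1 h2).le
  have hsuff : ∀ i, a ≤ i → i ≤ b → ∃ R, (g i).2 = R ++ x :: T := by
    intro i hai
    induction i, hai using Nat.le_induction with
    | base => exact fun _ => ⟨[], by simpa using hxT⟩
    | succ i hai ih =>
      intro hib
      obtain ⟨R, hR⟩ := ih (by omega)
      obtain ⟨-, f, -, hf⟩ := hg i (by omega)
      by_cases hR0 : R = []
      · have hi : (g i).2.length = k := by simp [hR, hR0, hTk]
        have hia : i = a := by
          by_contra hne
          have := hmid i (by omega) (by omega)
          omega
        subst hia
        rcases hib.eq_or_lt with hib | hib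
        · have : i = m ∨ i + 1 = m := by omega
          rcases this with h | h
          · have := hb i h.ge (by omega)
            omega
          · have := ha (i + 1) (by omega) h.le
            rw [hib] at this
            omega
        · obtain ⟨y, hy⟩ := f.apply_eq_cons_of_length_lt hf
            (by have := hmid (i + 1) (by omega) hib; omega)
          exact ⟨[y], by simp [hy, hxT]⟩
      · rw [hR] at hf
        exact f.exists_append_of_apply hR0 hf
  have hgb : (g b).2 = x :: T := by
    obtain ⟨R, hR⟩ := hsuff b (by omega) le_rfl
    have hR0 : R = [] := by
      have := congrArg List.length hR
      simp at this
      exact List.eq_nil_of_length_eq_zero (by omega)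
    simpa [hR0] using hR
  refine ⟨a, b, x, T, ham, hmb, hbl, hxT, hgb, hTk, hge, fun T' => ?_⟩
  choose! R hR using hsuff
  have hRa : R a = [] := by
    have := hR a le_rfl (by omega)
    simpa [hxT] using this
  have hRb : R b = [] := by
    have := hR b (by omega) le_rfl
    simpa [hgb] using this
  have := run_of_forall_step (N := N) (g := fun i => ((g i).1, R i ++ x :: T'))
    (ham.trans hmb) fun i h1 h2 => by
      obtain ⟨hE, f, hF, hf⟩ := hg i (by omega)
      refine ⟨hE, f, hF, ?_⟩
      rw [hR i h1 h2.le, hR (i + 1) (by omega) h2] at hf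
      have := f.apply_append_congr (R := R i ++ [x]) (R' := R (i + 1) ++ [x]) (T := T) T'
        (by simp) (by simp) (by simpa using hf)
      simpa using this
  simpa [hRa, hRb] using this

/-- A run between stacks of height one that rises above `γ·n²` can be shortened. -/
theorem exists_shorter_run [Fintype A] [Fintype V] {g : ℕ → V × List A} {l m : ℕ} (hml : m ≤ l)
    (hg : ∀ i < l, N.Step (g i) (g (i + 1))) (h0 : (g 0).2.length = 1)
    (hl : (g l).2.length = 1)
    (hm : Fintype.card A * Fintype.card V ^ 2 < (g m).2.length) :
    ∃ n < l, N.Run n (g 0) (g l) := by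
  have hex := fun k : Fin (g m).2.length => exists_excursion (k := k + 1) hml hg (by omega)
    (by omega) (by omega) (by omega)
  choose a b x T ham hmb hbl hga hgb hT hge hrun using hex
  obtain ⟨i, j, hij, heq⟩ := Fintype.exists_ne_map_eq_of_card_lt
    (fun k => (x k, (g (a k)).1, (g (b k)).1)) (by simpa [sq] using hm)
  wlog hlt : i < j generalizing i j
  · exact this j i hij.symm heq.symm (lt_of_le_of_ne (not_lt.mp hlt) hij.symm)
  simp only [Prod.mk.injEq] at heq
  obtain ⟨hx, hU, hW⟩ := heq
  have hai : (g (a i)).2.length = i + 1 := by simp [hga, hT]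
  have hbi : (g (b i)).2.length = i + 1 := by simp [hgb, hT]
  have hlt' : (i : ℕ) < j := hlt
  have haa : a i < a j := by
    by_contra h
    have := hge j (a i) (by omega) ((ham i).trans (hmb j))
    omega
  have hbb : b j < b i := by
    by_contra h
    have := hge j (b i) ((ham j).trans (hmb i)) (by omega)
    omega
  have hmid := hrun j (T i)
  rw [← hx, ← hU, ← hW, ← hga i] at hmid
  nth_rewrite 2 [hga i] at hmid
  rw [← hgb i] at hmid
  have hpre := run_of_forall_step (N := N) (g := g) (Nat.zero_le (a i))
    fun t _ ht => hg t (by have := ham i; omega)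
  have hpost := run_of_forall_step (N := N) (g := g) (hbl i) fun t _ ht => hg t ht
  exact ⟨_, by have := ham j; have := hmb j; have := hbl i; omega, (hpre.trans hmid).trans hpost⟩

end Network

/-- Every feasible path from `S` to `D` with the minimum number of hops among all
feasible paths from `S` to `D` reaches a maximum stack height of at most `γ·n²`. -/
theorem min_hop_feasible_path_maxHeight_le {A V : Type} [DecidableEq A] [Fintype A] [Fintype V]
    (γ n : ℕ) (hγ : Fintype.card A = γ) (hn : Fintype.card V = n)
    (N : Network A V) (S D : V) (P : NetPath A V)
    (hP : Feasible N S D P)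
    (hmin : ∀ Q : NetPath A V, Feasible N S D Q → P.len + 1 ≤ Q.len + 1) :
    P.maxHeight ≤ γ * n ^ 2 := by
  subst hγ hn
  obtain ⟨hS, hD, hE, hF, ⟨x, hx⟩, hsome, y, hy, hend⟩ := hP
  refine Finset.sup_le fun m hm => ?_
  have hml : m ≤ P.len := by simpa [Nat.lt_succ_iff] using hm
  by_contra! hlt
  let g : ℕ → V × List A := fun i => (P.nodes (i + 1), (P.stack i).getD [])
  have hstack : ∀ i ≤ P.len, P.stack i = some (g i).2 := fun i hi => by
    obtain ⟨L, hL⟩ := Option.isSome_iff_exists.mp (hsome i hi)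
    simp [g, hL]
  have hg0 : g 0 = (P.nodes 1, [x]) := by simp [g, NetPath.stack, hx]
  have hgl : g P.len = (D, [y]) := by simp [g, hend, hD]
  have hstep : ∀ i < P.len, N.Step (g i) (g (i + 1)) := fun i hi => by
    refine ⟨hE (i + 1) hi, P.funs (i + 1), hF (i + 1) (by omega) hi, ?_⟩
    have := hstack (i + 1) hi
    rwa [NetPath.stack, hstack i hi.le] at this
  obtain ⟨n, hn, hrun⟩ := Network.exists_shorter_run hml hstep (by simp [hg0]) (by simp [hgl])
    (by simpa [hstack m hml] using hlt)
  rw [hg0, hgl] at hrun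
  obtain ⟨Q, hQ, rfl⟩ := hrun.exists_feasible (S := S) (hS ▸ hE 0 (Nat.zero_le _)) hy
  have := hmin Q hQ
  omega
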